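/- arXiv:2405.00222 — 2 statements merged into one kernel-verified Lean document; each statement's English description precedes it below -/
import Mathlib

section
/- Pauli-Z measurement with outcome 0 deletes the measured vertex from a graph state: for every simple graph G on Fin n (n ≥ 1), every vertex q : Fin n, and every x : Fin n → Fin 2 with x(q) = 0, the amplitude of |G⟩ at x equals 2^{-1/2} times the amplitude of |G − q⟩ at the restriction of x to the remaining n−1 coordinates. -/
open scoped Classical

/-- The phase contributed by a CZ gate on the (unordered) pair of qubits `e`,
at computational-basis index `x`: `(-1)^(x u * x v)`. -/
noncomputable def czPhase {V : Type*} (x : V → Fin 2) (e : Sym2 V) : ℂ :=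
  Sym2.lift ⟨fun u v => (-1 : ℂ) ^ ((x u : ℕ) * (x v : ℕ)),
    fun u v => by simp [Nat.mul_comm]⟩ e

/-- The graph state `|G⟩` of a simple graph `G` on a finite vertex type, as an
amplitude function on computational-basis indices: it is obtained by applying the
(commuting, diagonal) CZ gates of all edges of `G` to the uniform `|+⟩^{⊗n}` state,
whose every amplitude is `2^(-n/2) = (√2)⁻¹ ^ n`. -/
noncomputable def graphState {V : Type*} [Fintype V] (G : SimpleGraph V)
    (x : V → Fin 2) : ℂ :=
  (∏ e ∈ G.edgeFinset, czPhase x e) * (((Real.sqrt 2 : ℝ) : ℂ))⁻¹ ^ (Fintype.card V)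


/-- `G.deleteVertex q` is the induced subgraph of `G` on the vertices other than `q`,
relabeled along the unique monotone bijection `Fin.succAbove q` between
`Fin (n+1) \ {q}` and `Fin n`. -/
def SimpleGraph.deleteVertex {n : ℕ} (G : SimpleGraph (Fin (n + 1))) (q : Fin (n + 1)) :
    SimpleGraph (Fin n) :=
  G.comap q.succAbove

@[simp]
theorem czPhase_mk {V : Type*} (x : V → Fin 2) (u v : V) :
    czPhase x s(u, v) = (-1 : ℂ) ^ ((x u : ℕ) * (x v : ℕ)) :=
  rfl

theorem czPhase_map {V W : Type*} (f : V → W) (x : W → Fin 2) (e : Sym2 V) :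
    czPhase x (e.map f) = czPhase (x ∘ f) e := by
  induction e with | h u v => rfl

theorem czPhase_eq_one_of_mem {V : Type*} {x : V → Fin 2} {q : V} {e : Sym2 V}
    (hq : q ∈ e) (hx : x q = 0) : czPhase x e = 1 := by
  obtain ⟨v, rfl⟩ := hq
  simp [hx]

/-- The total CZ phase of an induced subgraph agrees with that of the whole graph when all
vertices outside the subgraph carry the bit `0`. -/
theorem prod_czPhase_comap {V W : Type*} [Fintype V] [Fintype W] (G : SimpleGraph W)
    {H : SimpleGraph V} {f : V → W} (hH : H = G.comap f) (hf : Function.Injective f) {x : W → Fin 2}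
    (hx : ∀ w ∉ Set.range f, x w = 0) :
    ∏ e ∈ H.edgeFinset, czPhase (x ∘ f) e = ∏ e ∈ G.edgeFinset, czPhase x e := by
  subst hH
  refine Finset.prod_of_injOn (Sym2.map f) (Sym2.map.injective hf).injOn ?_ ?_
    fun e _ => (czPhase_map f x e).symm
  · intro e he
    induction e with | h u v => simpa using he
  · intro e he hne
    induction e with | h u v =>
    by_cases hu : u ∈ Set.range f
    · by_cases hv : v ∈ Set.range f
      · obtain ⟨a, rfl⟩ := hu
        obtain ⟨b, rfl⟩ := hv
        exact absurd ⟨s(a, b), by simpa using he, rfl⟩ hne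
      · exact czPhase_eq_one_of_mem (Sym2.mem_mk_right u v) (hx v hv)
    · exact czPhase_eq_one_of_mem (Sym2.mem_mk_left u v) (hx u hu)

/-- Pauli-Z measurement with outcome `0` deletes the measured vertex: if `x q = 0`,
the amplitude of `|G⟩` at `x` equals `2^(-1/2)` times the amplitude of `|G − q⟩`
at the restriction of `x` to the remaining coordinates. -/
theorem graphState_measureZ_zero (n : ℕ) (G : SimpleGraph (Fin (n + 1)))
    (q : Fin (n + 1)) (x : Fin (n + 1) → Fin 2) (hx : x q = 0) :
    graphState G x =
      (((Real.sqrt 2 : ℝ) : ℂ))⁻¹ *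
        graphState (G.deleteVertex q) (x ∘ q.succAbove) := by
  have hphase := prod_czPhase_comap G (H := G.deleteVertex q) (x := x) rfl
    Fin.succAbove_right_injective fun w hw => by
      rw [Fin.range_succAbove, Set.mem_compl_singleton_iff, not_not] at hw
      rw [hw, hx]
  simp only [graphState, Fintype.card_fin, hphase]
  ring
end

section
/- The 3/2-factor estimate of the latency recurrence is an upper bound in the heterogeneous case: if X and Y are independent random variables, exponentially distributed with rates λ₁ > 0 and λ₂ > 0 respectively, then the expectation of max(X, Y) is at most (3/2)·max(1/λ₁, 1/λ₂). -/
open MeasureTheory ProbabilityTheory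

/-- The distribution function of an exponential random variable on `[0, ∞)`. -/
lemma measureReal_le_of_map_eq_expMeasure {Ω : Type*} [MeasurableSpace Ω] {μ : Measure Ω}
    {X : Ω → ℝ} (hXm : Measurable X) {r : ℝ} (hr : 0 < r)
    (hX : μ.map X = expMeasure r) {t : ℝ} (ht : 0 ≤ t) :
    μ.real (X ⁻¹' Set.Iic t) = 1 - Real.exp (-(r * t)) := by
  have := isProbabilityMeasure_expMeasure hr
  rw [← map_measureReal_apply hXm measurableSet_Iic, hX, ← cdf_eq_real, cdf_expMeasure_eq hr,
    if_pos ht]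

/-- An exponential random variable is almost surely positive. -/
lemma ae_pos_of_map_eq_expMeasure {Ω : Type*} [MeasurableSpace Ω] {μ : Measure Ω}
    [IsFiniteMeasure μ] {X : Ω → ℝ} (hXm : Measurable X) {r : ℝ} (hr : 0 < r)
    (hX : μ.map X = expMeasure r) : ∀ᵐ ω ∂μ, 0 < X ω := by
  have h := measureReal_le_of_map_eq_expMeasure hXm hr hX le_rfl
  rw [mul_zero, neg_zero, Real.exp_zero, sub_self, measureReal_eq_zero_iff] at h
  rw [ae_iff]
  convert h using 2
  ext ω
  simp

/-- The tail of the maximum of two independent random variables. -/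
lemma measureReal_lt_max_of_indepFun {Ω : Type*} [MeasurableSpace Ω] {μ : Measure Ω}
    [IsProbabilityMeasure μ] {X Y : Ω → ℝ} (hXm : Measurable X) (hYm : Measurable Y)
    (hInd : IndepFun X Y μ) (t : ℝ) :
    μ.real {ω | t < max (X ω) (Y ω)} =
      1 - μ.real (X ⁻¹' Set.Iic t) * μ.real (Y ⁻¹' Set.Iic t) := by
  have hset : {ω | t < max (X ω) (Y ω)} = (X ⁻¹' Set.Iic t ∩ Y ⁻¹' Set.Iic t)ᶜ := by
    ext ω
    simp [imp_iff_not_or]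
  rw [hset, probReal_compl_eq_one_sub ((hXm measurableSet_Iic).inter (hYm measurableSet_Iic))]
  simp only [measureReal_def, hInd.measure_inter_preimage_eq_mul _ _ measurableSet_Iic
    measurableSet_Iic, ENNReal.toReal_mul]

/-- The `3/2`-factor estimate of the latency recurrence is an upper bound in the
heterogeneous case: if `X` and `Y` are independent random variables, exponentially
distributed with rates `l₁ > 0` and `l₂ > 0` (hence with means `1/l₁` and `1/l₂`),
then `E[max(X, Y)] ≤ (3/2)·max(1/l₁, 1/l₂)`. -/
theorem expectation_max_exponential_le
    {Ω : Type*} [MeasureSpace Ω] [IsProbabilityMeasure (ℙ : Measure Ω)]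
    (X Y : Ω → ℝ) (hXm : Measurable X) (hYm : Measurable Y)
    (l₁ l₂ : ℝ) (hl₁ : 0 < l₁) (hl₂ : 0 < l₂)
    (hX : Measure.map X ℙ = expMeasure l₁)
    (hY : Measure.map Y ℙ = expMeasure l₂)
    (hInd : IndepFun X Y ℙ) :
    ∫ ω, max (X ω) (Y ω) ∂ℙ ≤ 3 / 2 * max (1 / l₁) (1 / l₂) := by
  by_cases hint : Integrable (fun ω ↦ max (X ω) (Y ω)) (ℙ : Measure Ω)
  swap
  · rw [integral_undef hint]
    positivity
  obtain ⟨m, hm, hm₁, hm₂, hmax⟩ : ∃ m, 0 < m ∧ m ≤ l₁ ∧ m ≤ l₂ ∧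
      1 / m ≤ max (1 / l₁) (1 / l₂) := by
    rcases le_total l₁ l₂ with h | h
    · exact ⟨l₁, hl₁, le_rfl, h, le_max_left _ _⟩
    · exact ⟨l₂, hl₂, h, le_rfl, le_max_right _ _⟩
  have hnn : 0 ≤ᵐ[ℙ] fun ω ↦ max (X ω) (Y ω) := by
    filter_upwards [ae_pos_of_map_eq_expMeasure hXm hl₁ hX] with ω h
    exact h.le.trans (le_max_left _ _)
  have hi₁ : IntegrableOn (fun t ↦ 2 * Real.exp (-m * t)) (Set.Ioi 0) :=
    (exp_neg_integrableOn_Ioi 0 hm).const_mul 2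
  have hi₂ : IntegrableOn (fun t ↦ Real.exp (-(2 * m) * t)) (Set.Ioi 0) :=
    exp_neg_integrableOn_Ioi 0 (by positivity)
  calc ∫ ω, max (X ω) (Y ω) ∂ℙ
      = ∫ t in Set.Ioi 0, (ℙ : Measure Ω).real {ω | t < max (X ω) (Y ω)} :=
        hint.integral_eq_integral_meas_lt hnn
    _ ≤ ∫ t in Set.Ioi 0, (2 * Real.exp (-m * t) - Real.exp (-(2 * m) * t)) := by
        refine integral_mono_of_nonneg (.of_forall fun _ ↦ measureReal_nonneg) (hi₁.sub hi₂) ?_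
        filter_upwards [ae_restrict_mem measurableSet_Ioi] with t ht
        have ht : 0 < t := ht
        have hw : Real.exp (-m * t) ≤ 1 := Real.exp_le_one_iff.2 (by nlinarith)
        have h₁ : Real.exp (-(l₁ * t)) ≤ Real.exp (-m * t) := Real.exp_le_exp.2 (by nlinarith)
        have h₂ : Real.exp (-(l₂ * t)) ≤ Real.exp (-m * t) := Real.exp_le_exp.2 (by nlinarith)
        have hsq : Real.exp (-(2 * m) * t) = Real.exp (-m * t) * Real.exp (-m * t) := by
          rw [← Real.exp_add]
          ring_nf
        rw [measureReal_lt_max_of_indepFun hXm hYm hInd,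
          measureReal_le_of_map_eq_expMeasure hXm hl₁ hX ht.le,
          measureReal_le_of_map_eq_expMeasure hYm hl₂ hY ht.le, hsq]
        nlinarith
    _ = 3 / 2 * (1 / m) := by
        rw [integral_sub hi₁ hi₂, integral_const_mul, integral_exp_mul_Ioi (by linarith),
          integral_exp_mul_Ioi (by linarith)]
        simp only [mul_zero, Real.exp_zero]
        field_simp
        norm_num
    _ ≤ 3 / 2 * max (1 / l₁) (1 / l₂) := by gcongr
end
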